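/- Let T be a polyhedral element, fix a face f_j with unit normal n_j, let t₁, t₂ be orthonormal tangent vectors of the plane of f_j, and let π_j denote the orthogonal projection of ℝ³ onto the plane of f_j. Let k ≥ 1 be an integer, let v₀ ∈ [P_k(T)]³, and let v_n = v₃t₁ + v₄t₂ where v₃, v₄ are polynomials of total degree at most k−1 on the plane of f_j. Define q : T → ℝ³ by q(X) = ((v_n − ∇×v₀) × n_j)(π_j(X)) · φ_{f_j}(X), where (v_n − ∇×v₀) × n_j is evaluated at the projected point π_j(X). Then there exists a constant C, depending only on T and k, such that ‖q‖²_{L²(T)} ≤ C h_T ∫_{f_j} |(v_n − ∇×v₀) × n_j|² dS. -/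

import Mathlib

open MeasureTheory

noncomputable section

/-- `ℝ³` as a Euclidean space. -/
abbrev E3 : Type := EuclideanSpace ℝ (Fin 3)

/-- The Euclidean dot product on `ℝ³`. -/
def dot3 (a b : E3) : ℝ := ∑ i : Fin 3, a i * b i

/-- The cross product on `ℝ³`. -/
def cross3 (a b : E3) : E3 :=
  (EuclideanSpace.equiv (Fin 3) ℝ).symm
    ![a 1 * b 2 - a 2 * b 1, a 2 * b 0 - a 0 * b 2, a 0 * b 1 - a 1 * b 0]

/-- Partial derivative in the `i`-th coordinate direction. -/
def pd (i : Fin 3) (f : E3 → ℝ) (x : E3) : ℝ := fderiv ℝ f x (EuclideanSpace.single i 1)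

/-- The gradient of a scalar field on `ℝ³`. -/
def grad3 (f : E3 → ℝ) (x : E3) : E3 :=
  (EuclideanSpace.equiv (Fin 3) ℝ).symm ![pd 0 f x, pd 1 f x, pd 2 f x]

/-- The divergence of a vector field on `ℝ³`. -/
def div3 (v : E3 → E3) (x : E3) : ℝ := ∑ i : Fin 3, pd i (fun y => v y i) x

/-- The curl of a vector field on `ℝ³`. -/
def curl3 (v : E3 → E3) (x : E3) : E3 :=
  (EuclideanSpace.equiv (Fin 3) ℝ).symm
    ![pd 1 (fun y => v y 2) x - pd 2 (fun y => v y 1) x,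
      pd 2 (fun y => v y 0) x - pd 0 (fun y => v y 2) x,
      pd 0 (fun y => v y 1) x - pd 1 (fun y => v y 0) x]

/-- The curl-curl operator `(∇×)²`. -/
def curlcurl3 (v : E3 → E3) : E3 → E3 := curl3 (curl3 v)

/-- `f : ℝ³ → ℝ` is (globally) a real polynomial of total degree at most `k`. -/
def PolyFun (k : ℕ) (f : E3 → ℝ) : Prop :=
  ∃ p : MvPolynomial (Fin 3) ℝ, p.totalDegree ≤ k ∧
    ∀ x : E3, f x = MvPolynomial.eval (fun i => x i) p

/-- `v : ℝ³ → ℝ³` is componentwise a polynomial of total degree at most `k`. -/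
def PolyVec (k : ℕ) (v : E3 → E3) : Prop := ∀ c : Fin 3, PolyFun k (fun x => v x c)

/-- A (possibly non-convex) polyhedral element in `ℝ³`: a nonempty bounded open set whose
boundary is the union of `N` planar compact faces of positive two-dimensional Hausdorff
measure, with outward unit normals. -/
structure PolyhedralElement (N : ℕ) where
  carrier : Set E3
  face : Fin N → Set E3
  normal : Fin N → E3
  basept : Fin N → E3
  carrier_nonempty : carrier.Nonempty
  carrier_isOpen : IsOpen carrier
  carrier_isBounded : Bornology.IsBounded carrier
  frontier_eq : frontier carrier = ⋃ i, face i
  face_isCompact : ∀ i, IsCompact (face i)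
  face_pos : ∀ i, 0 < μH[(2 : ℝ)] (face i)
  face_inter_null : ∀ i j, i ≠ j → μH[(2 : ℝ)] (face i ∩ face j) = 0
  normal_unit : ∀ i, ‖normal i‖ = 1
  basept_mem : ∀ i, basept i ∈ face i
  face_planar : ∀ i, ∀ x ∈ face i, dot3 (x - basept i) (normal i) = 0
  normal_outward : ∀ i, ∀ x ∈ face i, (∀ j, j ≠ i → x ∉ face j) →
    ∃ ε > (0 : ℝ), ∀ t : ℝ, 0 < t → t < ε →
      x + t • normal i ∉ carrier ∧ x - t • normal i ∈ carrier

namespace PolyhedralElement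

variable {N : ℕ} (P : PolyhedralElement N)

/-- The element size `h_T = diam T`. -/
def hT : ℝ := Metric.diam P.carrier

/-- The affine function `l_i(x) = (x − A_i)·n_i / h_T`, vanishing on face `f_i`. -/
def lfun (i : Fin N) (x : E3) : ℝ := dot3 (x - P.basept i) (P.normal i) / P.hT

/-- The element bubble function `Φ_B = l₁² ⋯ l_N²`. -/
def bubble (x : E3) : ℝ := ∏ i, (P.lfun i x) ^ 2

/-- The face bubble function `φ_{f_j} = ∏_{i ≠ j} l_i²`. -/
def faceBubble (j : Fin N) (x : E3) : ℝ := ∏ i ∈ Finset.univ.erase j, (P.lfun i x) ^ 2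

/-- Orthogonal projection of `ℝ³` onto the plane of face `f_j`. -/
def faceProj (j : Fin N) (x : E3) : E3 :=
  x - dot3 (x - P.basept j) (P.normal j) • P.normal j

/-- `nv` is (a version of) the outward unit normal field on `∂T`: on the boundary it always
equals one of the face normals, and at every point lying on exactly one face it equals the
outward normal of that face. -/
def IsOutwardNormal (nv : E3 → E3) : Prop :=
  Measurable nv ∧
  (∀ x ∈ frontier P.carrier, ∃ i, x ∈ P.face i ∧ nv x = P.normal i) ∧
  (∀ i, ∀ x ∈ P.face i, (∀ j, j ≠ i → x ∉ P.face j) → nv x = P.normal i)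

/-- `G` is the discrete weak gradient `∇_{w,r,T}{σ₀, σ_b}`. -/
def IsWeakGradient (r : ℕ) (nv : E3 → E3) (σ₀ σb : E3 → ℝ) (G : E3 → E3) : Prop :=
  PolyVec r G ∧
  ∀ ψ : E3 → E3, PolyVec r ψ →
    (∫ x in P.carrier, dot3 (G x) (ψ x)) =
      -(∫ x in P.carrier, σ₀ x * div3 ψ x) +
      ∫ x in frontier P.carrier, σb x * dot3 (ψ x) (nv x) ∂(μH[(2 : ℝ)])

/-- `G` is the discrete weak curl-curl `(∇×)²_{w,r,T}{v₀, v_b, v_n}`. -/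
def IsWeakCurlCurl (r : ℕ) (nv : E3 → E3) (v₀ vb vn : E3 → E3) (G : E3 → E3) : Prop :=
  PolyVec r G ∧
  ∀ q : E3 → E3, PolyVec r q →
    (∫ x in P.carrier, dot3 (G x) (q x)) =
      (∫ x in P.carrier, dot3 (v₀ x) (curlcurl3 q x))
      - (∫ x in frontier P.carrier, dot3 (cross3 (vb x) (nv x)) (curl3 q x) ∂(μH[(2 : ℝ)]))
      - ∫ x in frontier P.carrier, dot3 (cross3 (vn x) (nv x)) (q x) ∂(μH[(2 : ℝ)])

end PolyhedralElement

section FiniteDimensional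

/-- Two linear maps on a finite-dimensional space with nested kernels are comparable in norm. -/
theorem LinearMap.exists_norm_le_mul_norm_of_ker_le {V X Y : Type*} [AddCommGroup V] [Module ℝ V]
    [FiniteDimensional ℝ V] [NormedAddCommGroup X] [NormedSpace ℝ X]
    [NormedAddCommGroup Y] [NormedSpace ℝ Y] (F : V →ₗ[ℝ] X) (G : V →ₗ[ℝ] Y)
    (h : LinearMap.ker G ≤ LinearMap.ker F) :
    ∃ C : ℝ, ∀ v, ‖F v‖ ≤ C * ‖G v‖ := by
  obtain ⟨s, hs⟩ := G.rangeRestrict.exists_rightInverse_of_surjective G.range_rangeRestrict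
  let H : LinearMap.range G →L[ℝ] X := LinearMap.toContinuousLinearMap (F ∘ₗ s)
  refine ⟨‖H‖, fun v => ?_⟩
  have hHv : H (G.rangeRestrict v) = F v := by
    have h₁ : G.rangeRestrict (s (G.rangeRestrict v)) = G.rangeRestrict v :=
      LinearMap.congr_fun hs _
    have h₂ : s (G.rangeRestrict v) - v ∈ LinearMap.ker F := h <| by
      rw [LinearMap.mem_ker, map_sub, sub_eq_zero]
      exact congrArg Subtype.val h₁
    rw [LinearMap.mem_ker, map_sub, sub_eq_zero] at h₂
    exact h₂
  rw [← hHv]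
  exact H.le_opNorm _

/-- A linear family of square-integrable functions, as a linear map into `L²`. -/
def linearToL2 {V α : Type*} [AddCommGroup V] [Module ℝ V] [MeasurableSpace α] {μ : Measure α}
    (F : V →ₗ[ℝ] (α → ℝ)) (hF : ∀ v, MemLp (F v) 2 μ) : V →ₗ[ℝ] Lp ℝ 2 μ where
  toFun v := (hF v).toLp (F v)
  map_add' v w := by
    rw [← MemLp.toLp_add]
    simp only [map_add]
  map_smul' c v := by
    rw [RingHom.id_apply, ← MemLp.toLp_const_smul]
    simp only [map_smul]

theorem norm_linearToL2_sq {V α : Type*} [AddCommGroup V] [Module ℝ V] [MeasurableSpace α]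
    {μ : Measure α} (F : V →ₗ[ℝ] (α → ℝ)) (hF : ∀ v, MemLp (F v) 2 μ) (v : V) :
    ‖linearToL2 F hF v‖ ^ 2 = ∫ x, F v x ^ 2 ∂μ := by
  rw [← real_inner_self_eq_norm_sq, L2.inner_def]
  refine integral_congr_ae ?_
  filter_upwards [(hF v).coeFn_toLp] with x hx
  have : (linearToL2 F hF v) x = F v x := hx
  simp [this]

/-- Comparison of `L²` seminorms on a finite-dimensional space of functions. -/
theorem exists_integral_sq_le_mul_integral_sq {V α β : Type*} [AddCommGroup V] [Module ℝ V]
    [FiniteDimensional ℝ V] [MeasurableSpace α] [MeasurableSpace β] {μ : Measure α}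
    {ν : Measure β} (F : V →ₗ[ℝ] (α → ℝ)) (G : V →ₗ[ℝ] (β → ℝ))
    (hF : ∀ v, MemLp (F v) 2 μ) (hG : ∀ v, MemLp (G v) 2 ν)
    (h : ∀ v, G v =ᵐ[ν] 0 → F v = 0) :
    ∃ C : ℝ, ∀ v, ∫ x, F v x ^ 2 ∂μ ≤ C * ∫ x, G v x ^ 2 ∂ν := by
  obtain ⟨C, hC⟩ := LinearMap.exists_norm_le_mul_norm_of_ker_le
    (linearToL2 F hF) (linearToL2 G hG) (fun v hv => by
      rw [LinearMap.mem_ker] at hv ⊢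
      have hGv : G v =ᵐ[ν] 0 := by
        rwa [← MemLp.toLp_eq_toLp_iff (hG v) MemLp.zero, MemLp.toLp_zero]
      have : linearToL2 F hF v = (MemLp.zero : MemLp (0 : α → ℝ) 2 μ).toLp 0 :=
        (MemLp.toLp_eq_toLp_iff (hF v) MemLp.zero).2 (by rw [h v hGv])
      rw [this, MemLp.toLp_zero])
  refine ⟨C ^ 2, fun v => ?_⟩
  rw [← norm_linearToL2_sq F hF, ← norm_linearToL2_sq G hG, ← mul_pow]
  exact pow_le_pow_left₀ (norm_nonneg _) (hC v) 2

end FiniteDimensional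

section PolynomialFunctions

/-- Evaluation of a polynomial in three variables as a function on `ℝ³`. -/
def evalE3 : MvPolynomial (Fin 3) ℝ →ₗ[ℝ] (E3 → ℝ) where
  toFun p x := MvPolynomial.eval (fun i => x i) p
  map_add' p q := by ext x; simp
  map_smul' c p := by ext x; simp

/-- The space of polynomial functions on `ℝ³` of total degree at most `k`. -/
def polySubmodule (k : ℕ) : Submodule ℝ (E3 → ℝ) :=
  (MvPolynomial.restrictTotalDegree (Fin 3) ℝ k).map evalE3

theorem mem_polySubmodule {k : ℕ} {f : E3 → ℝ} : f ∈ polySubmodule k ↔ PolyFun k f := by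
  simp only [polySubmodule, Submodule.mem_map, MvPolynomial.mem_restrictTotalDegree, PolyFun]
  exact exists_congr fun p => and_congr_right fun _ =>
    ⟨fun h x => (congrFun h x).symm, fun h => funext fun x => (h x).symm⟩

instance (k : ℕ) : FiniteDimensional ℝ (polySubmodule k) :=
  inferInstanceAs (FiniteDimensional ℝ
    ((MvPolynomial.restrictTotalDegree (Fin 3) ℝ k).map evalE3))

theorem PolyFun.mono {k l : ℕ} (h : k ≤ l) {f : E3 → ℝ} (hf : PolyFun k f) : PolyFun l f :=
  let ⟨p, hp, hfp⟩ := hf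
  ⟨p, hp.trans h, hfp⟩

theorem PolyFun.add {k : ℕ} {f g : E3 → ℝ} (hf : PolyFun k f) (hg : PolyFun k g) :
    PolyFun k (fun x => f x + g x) :=
  mem_polySubmodule.1 (add_mem (mem_polySubmodule.2 hf) (mem_polySubmodule.2 hg))

theorem PolyFun.sub {k : ℕ} {f g : E3 → ℝ} (hf : PolyFun k f) (hg : PolyFun k g) :
    PolyFun k (fun x => f x - g x) :=
  mem_polySubmodule.1 (sub_mem (mem_polySubmodule.2 hf) (mem_polySubmodule.2 hg))

theorem PolyFun.mul_const {k : ℕ} {f : E3 → ℝ} (hf : PolyFun k f) (c : ℝ) :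
    PolyFun k (fun x => f x * c) := by
  have := mem_polySubmodule.1 (Submodule.smul_mem _ c (mem_polySubmodule.2 hf))
  simpa [PolyFun, mul_comm] using this

theorem PolyFun.continuous {k : ℕ} {f : E3 → ℝ} (hf : PolyFun k f) : Continuous f := by
  obtain ⟨p, -, hfp⟩ := hf
  rw [funext hfp]
  exact (MvPolynomial.continuous_eval p).comp (by fun_prop)

theorem MvPolynomial.totalDegree_pderiv_le {σ R : Type*} [CommSemiring R] (i : σ)
    (p : MvPolynomial σ R) : (MvPolynomial.pderiv i p).totalDegree ≤ p.totalDegree := by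
  refine Finset.sup_le fun m hm => ?_
  rw [MvPolynomial.mem_support_iff, MvPolynomial.coeff_pderiv] at hm
  have h := MvPolynomial.le_totalDegree
    (MvPolynomial.mem_support_iff.2 (left_ne_zero_of_mul hm))
  rw [Finsupp.sum_add_index' (fun _ => rfl) (fun _ _ _ => rfl)] at h
  exact (Nat.le_add_right _ _).trans h

theorem hasFDerivAt_evalE3 (p : MvPolynomial (Fin 3) ℝ) (x : E3) :
    HasFDerivAt (evalE3 p)
      (∑ i, evalE3 (MvPolynomial.pderiv i p) x • EuclideanSpace.proj (𝕜 := ℝ) i) x := by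
  induction p using MvPolynomial.induction_on with
  | C a =>
    have : evalE3 (MvPolynomial.C a) = fun _ => a := by ext; simp [evalE3]
    rw [this]
    simpa using hasFDerivAt_const a x
  | add p q hp hq =>
    rw [map_add]
    refine (hp.add hq).congr_fderiv ?_
    simp [add_smul, Finset.sum_add_distrib]
  | mul_X p j hp =>
    have hm : evalE3 (p * MvPolynomial.X j) = fun y => evalE3 p y * y j := by
      ext; simp [evalE3]
    rw [hm]
    refine (hp.mul (EuclideanSpace.proj (𝕜 := ℝ) j : E3 →L[ℝ] ℝ).hasFDerivAt).congr_fderiv ?_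
    have hd : ∀ i, evalE3 (MvPolynomial.pderiv i (p * MvPolynomial.X j)) x
        = evalE3 p x * (Pi.single i 1 : Fin 3 → ℝ) j
          + x j * evalE3 (MvPolynomial.pderiv i p) x := by
      intro i
      have hX : MvPolynomial.eval (fun i => x i) ((Pi.single i 1 : Fin 3 → _) j)
          = (Pi.single i 1 : Fin 3 → ℝ) j := by
        by_cases hij : j = i <;> simp [hij]
      simp [evalE3, MvPolynomial.pderiv_X, hX]
    simp only [hd, add_smul, Finset.sum_add_distrib, mul_smul, Finset.smul_sum]
    simp [Pi.single_apply, ite_smul]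

theorem PolyFun.pd {k : ℕ} {f : E3 → ℝ} (hf : PolyFun k f) (i : Fin 3) : PolyFun k (pd i f) := by
  obtain ⟨p, hp, hfp⟩ := hf
  refine ⟨MvPolynomial.pderiv i p, (MvPolynomial.totalDegree_pderiv_le i p).trans hp,
    fun x => ?_⟩
  have hf' : f = evalE3 p := funext hfp
  rw [_root_.pd, hf', (hasFDerivAt_evalE3 p x).fderiv]
  simp [evalE3]

theorem PolyFun.exists_polynomial_line {k : ℕ} {f : E3 → ℝ} (hf : PolyFun k f) (a d : E3) :
    ∃ u : Polynomial ℝ, ∀ t : ℝ, f (a + t • d) = u.eval t := by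
  obtain ⟨p, -, hfp⟩ := hf
  refine ⟨MvPolynomial.aeval
    (fun i => Polynomial.C (a i) + Polynomial.X * Polynomial.C (d i)) p, fun t => ?_⟩
  rw [hfp, ← Polynomial.coe_evalRingHom, MvPolynomial.aeval_def, MvPolynomial.hom_eval₂,
    MvPolynomial.eval, MvPolynomial.coe_eval₂Hom]
  congr 1
  · ext; simp
  · ext i; simp; ring

/-- A polynomial function not vanishing identically on a plane vanishes there on a null set of
parameters. -/
theorem PolyFun.volume_zeros_plane {k : ℕ} {f : E3 → ℝ} (hf : PolyFun k f) (a t₁ t₂ : E3)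
    {y₀ : ℝ × ℝ} (hy₀ : f (a + y₀.1 • t₁ + y₀.2 • t₂) ≠ 0) :
    volume {y : ℝ × ℝ | f (a + y.1 • t₁ + y.2 • t₂) = 0} = 0 := by
  have hline : ∀ b d : E3, ∀ s₀ : ℝ, f (b + s₀ • d) ≠ 0 →
      volume {s : ℝ | f (b + s • d) = 0} = 0 := by
    intro b d s₀ hs₀
    obtain ⟨u, hu⟩ := hf.exists_polynomial_line b d
    have hu0 : u ≠ 0 := by
      rintro rfl
      exact hs₀ (by simp [hu])
    refine Set.Finite.measure_zero ?_ _
    simp only [hu]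
    exact Polynomial.finite_setOfPred_isRoot hu0
  have hmeas : MeasurableSet {y : ℝ × ℝ | f (a + y.1 • t₁ + y.2 • t₂) = 0} := by
    have := hf.continuous
    exact (isClosed_eq (by fun_prop) continuous_const).measurableSet
  rw [Measure.volume_eq_prod, Measure.measure_prod_null hmeas]
  have h₁ : ∀ᵐ s : ℝ, f (a + y₀.2 • t₂ + s • t₁) ≠ 0 := by
    rw [ae_iff]
    simpa using hline (a + y₀.2 • t₂) t₁ y₀.1 (by rwa [add_right_comm])
  filter_upwards [h₁] with s hs
  exact hline (a + s • t₁) t₂ y₀.2 (by rwa [add_right_comm])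

end PolynomialFunctions

section Plane

theorem lipschitzWith_plane (a : E3) {t₁ t₂ : E3} (ht₁ : ‖t₁‖ = 1) (ht₂ : ‖t₂‖ = 1) :
    LipschitzWith 2 (fun y : ℝ × ℝ => a + y.1 • t₁ + y.2 • t₂) := by
  refine LipschitzWith.of_dist_le_mul fun x y => ?_
  have h : a + x.1 • t₁ + x.2 • t₂ - (a + y.1 • t₁ + y.2 • t₂)
      = (x.1 - y.1) • t₁ + (x.2 - y.2) • t₂ := by module
  rw [dist_eq_norm, h, dist_eq_norm]
  refine (norm_add_le _ _).trans ?_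
  rw [norm_smul, norm_smul, ht₁, ht₂]
  have h₁ := norm_fst_le (x - y)
  have h₂ := norm_snd_le (x - y)
  simp only [Prod.fst_sub, Prod.snd_sub] at h₁ h₂
  push_cast
  linarith

theorem hausdorffMeasure_image_plane_le (a : E3) {t₁ t₂ : E3} (ht₁ : ‖t₁‖ = 1) (ht₂ : ‖t₂‖ = 1)
    (s : Set (ℝ × ℝ)) :
    μH[(2 : ℝ)] ((fun y : ℝ × ℝ => a + y.1 • t₁ + y.2 • t₂) '' s) ≤ 4 * volume s := by
  refine ((lipschitzWith_plane a ht₁ ht₂).hausdorffMeasure_image_le zero_le_two s).trans ?_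
  rw [hausdorffMeasure_prod_real]
  refine mul_le_mul_left ?_ _
  norm_num

theorem dot3_eq_inner (a b : E3) : dot3 a b = inner ℝ a b := by
  simp [dot3, PiLp.inner_apply, mul_comm]

theorem eq_sum_of_orthonormal {t₁ t₂ n : E3} (ht₁ : ‖t₁‖ = 1) (ht₂ : ‖t₂‖ = 1) (hn : ‖n‖ = 1)
    (h₁₂ : dot3 t₁ t₂ = 0) (h₁n : dot3 t₁ n = 0) (h₂n : dot3 t₂ n = 0) (x : E3) :
    x = dot3 x t₁ • t₁ + dot3 x t₂ • t₂ + dot3 x n • n := by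
  rw [dot3_eq_inner] at h₁₂ h₁n h₂n
  have ho : Orthonormal ℝ ![t₁, t₂, n] := by
    refine ⟨fun i => ?_, fun i j hij => ?_⟩
    · fin_cases i <;> simp [ht₁, ht₂, hn]
    · fin_cases i <;> fin_cases j <;>
        simp_all [real_inner_comm]
  have hc : Fintype.card (Fin 3) = Module.finrank ℝ E3 := by simp
  let b := basisOfOrthonormalOfCardEqFinrank ho hc
  have hb : (b : Fin 3 → E3) = ![t₁, t₂, n] := coe_basisOfOrthonormalOfCardEqFinrank ho hc
  let B := b.toOrthonormalBasis (by rwa [hb])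
  have hB : (B : Fin 3 → E3) = ![t₁, t₂, n] := by
    rw [Module.Basis.coe_toOrthonormalBasis, hb]
  have := B.sum_repr' x
  rw [hB, Fin.sum_univ_three] at this
  simp only [dot3_eq_inner]
  simpa [real_inner_comm] using this.symm

end Plane

section Continuity

theorem Continuous.memLp_two_restrict_of_isBounded {μ : Measure E3} {S : Set E3} {f : E3 → ℝ}
    (hf : Continuous f) (hS : Bornology.IsBounded S) (hSm : MeasurableSet S) (hμ : μ S < ⊤) :
    MemLp f 2 (μ.restrict S) := by
  have : IsFiniteMeasure (μ.restrict S) := isFiniteMeasure_restrict.2 hμ.ne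
  obtain ⟨C, hC⟩ := hS.isCompact_closure.exists_bound_of_continuousOn hf.continuousOn
  refine MemLp.of_bound hf.aestronglyMeasurable C ?_
  filter_upwards [ae_restrict_mem hSm] with x hx
  exact hC x (subset_closure hx)

theorem continuous_dot3_sub (a n : E3) : Continuous fun x : E3 => dot3 (x - a) n := by
  simp only [dot3_eq_inner]
  fun_prop

theorem norm_sq_eq_sum (x : E3) : ‖x‖ ^ 2 = ∑ c, x c ^ 2 := by
  simp [EuclideanSpace.norm_sq_eq]

end Continuity

namespace PolyhedralElement

variable {N : ℕ} (P : PolyhedralElement N)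

theorem hT_pos : 0 < P.hT := by
  have hne : P.carrier.Nontrivial := by
    obtain ⟨x, hx⟩ := P.carrier_nonempty
    have : (nhdsWithin x {x}ᶜ).NeBot := Module.punctured_nhds_neBot ℝ E3 x
    exact (infinite_of_mem_nhds x (P.carrier_isOpen.mem_nhds hx)).nontrivial
  exact Metric.diam_pos hne P.carrier_isBounded

theorem continuous_lfun (i : Fin N) : Continuous (P.lfun i) :=
  (continuous_dot3_sub _ _).div_const _

theorem continuous_faceBubble (j : Fin N) : Continuous (P.faceBubble j) :=
  continuous_finsetProd _ fun i _ => (P.continuous_lfun i).pow 2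

theorem continuous_faceProj (j : Fin N) : Continuous (P.faceProj j) :=
  continuous_id.sub ((continuous_dot3_sub _ _).smul continuous_const)

variable {P} {j : Fin N} {t₁ t₂ : E3}

theorem faceProj_eq (ht₁ : ‖t₁‖ = 1) (ht₂ : ‖t₂‖ = 1) (ht₁₂ : dot3 t₁ t₂ = 0)
    (ht₁n : dot3 t₁ (P.normal j) = 0) (ht₂n : dot3 t₂ (P.normal j) = 0) (x : E3) :
    P.faceProj j x = P.basept j + dot3 (x - P.basept j) t₁ • t₁
      + dot3 (x - P.basept j) t₂ • t₂ := by
  have h := eq_sum_of_orthonormal ht₁ ht₂ (P.normal_unit j) ht₁₂ ht₁n ht₂n (x - P.basept j)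
  rw [sub_eq_iff_eq_add'] at h
  rw [faceProj, sub_eq_iff_eq_add, add_assoc, add_assoc, ← add_assoc (_ • t₁)]
  exact h

theorem faceProj_of_mem {x : E3} (hx : x ∈ P.face j) : P.faceProj j x = x := by
  rw [faceProj, P.face_planar j x hx, zero_smul, sub_zero]

theorem hausdorffMeasure_face_lt_top (ht₁ : ‖t₁‖ = 1) (ht₂ : ‖t₂‖ = 1) (ht₁₂ : dot3 t₁ t₂ = 0)
    (ht₁n : dot3 t₁ (P.normal j) = 0) (ht₂n : dot3 t₂ (P.normal j) = 0) :
    μH[(2 : ℝ)] (P.face j) < ⊤ := by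
  let c : E3 → ℝ × ℝ := fun x => (dot3 (x - P.basept j) t₁, dot3 (x - P.basept j) t₂)
  have hc : Continuous c := (continuous_dot3_sub _ _).prodMk (continuous_dot3_sub _ _)
  have hsub : P.face j ⊆
      (fun y : ℝ × ℝ => P.basept j + y.1 • t₁ + y.2 • t₂) '' (c '' P.face j) := by
    rintro x hx
    refine ⟨c x, ⟨x, hx, rfl⟩, ?_⟩
    exact (faceProj_eq ht₁ ht₂ ht₁₂ ht₁n ht₂n x).symm.trans (faceProj_of_mem hx)
  refine (measure_mono hsub).trans_lt
    ((hausdorffMeasure_image_plane_le _ ht₁ ht₂ _).trans_lt ?_)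
  exact ENNReal.mul_lt_top (by simp) ((P.face_isCompact j).image hc).measure_lt_top

theorem comp_faceProj_eq_zero_of_ae_face (ht₁ : ‖t₁‖ = 1) (ht₂ : ‖t₂‖ = 1)
    (ht₁₂ : dot3 t₁ t₂ = 0) (ht₁n : dot3 t₁ (P.normal j) = 0) (ht₂n : dot3 t₂ (P.normal j) = 0)
    {k : ℕ} {f : E3 → ℝ} (hf : PolyFun k f)
    (h : ∀ᵐ x ∂(μH[(2 : ℝ)] : Measure E3).restrict (P.face j), f x = 0) (x : E3) :
    f (P.faceProj j x) = 0 := by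
  by_contra hx
  rw [faceProj_eq ht₁ ht₂ ht₁₂ ht₁n ht₂n] at hx
  have hZ := hf.volume_zeros_plane (P.basept j) t₁ t₂
    (y₀ := (dot3 (x - P.basept j) t₁, dot3 (x - P.basept j) t₂)) hx
  have hZ' := hausdorffMeasure_image_plane_le (P.basept j) ht₁ ht₂
    {y : ℝ × ℝ | f (P.basept j + y.1 • t₁ + y.2 • t₂) = 0}
  rw [hZ, mul_zero, nonpos_iff_eq_zero] at hZ'
  rw [ae_restrict_iff' (P.face_isCompact j).measurableSet] at h
  refine (P.face_pos j).ne' (measure_mono_null ?_ (measure_union_null hZ' h))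
  intro z hz
  by_cases hfz : f z = 0
  · left
    have hz' := (faceProj_eq ht₁ ht₂ ht₁₂ ht₁n ht₂n z).symm.trans (faceProj_of_mem hz)
    exact ⟨(dot3 (z - P.basept j) t₁, dot3 (z - P.basept j) t₂),
      (congrArg f hz').trans hfz, hz'⟩
  · right
    exact fun h => hfz (h hz)

theorem memLp_faceBubble_mul_comp_faceProj {f : E3 → ℝ} (hf : Continuous f) :
    MemLp (fun x => P.faceBubble j x * f (P.faceProj j x)) 2 (volume.restrict P.carrier) :=
  ((P.continuous_faceBubble j).mul
    (hf.comp (P.continuous_faceProj j))).memLp_two_restrict_of_isBounded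
      P.carrier_isBounded P.carrier_isOpen.measurableSet P.carrier_isBounded.measure_lt_top

/-- Weighted trace inequality for polynomials extended off the plane of a face along its
normal. -/
theorem exists_integral_faceBubble_mul_sq_le (ht₁ : ‖t₁‖ = 1) (ht₂ : ‖t₂‖ = 1)
    (ht₁₂ : dot3 t₁ t₂ = 0) (ht₁n : dot3 t₁ (P.normal j) = 0) (ht₂n : dot3 t₂ (P.normal j) = 0)
    (k : ℕ) :
    ∃ C : ℝ, ∀ f : E3 → ℝ, PolyFun k f →
      ∫ x in P.carrier, (P.faceBubble j x * f (P.faceProj j x)) ^ 2 ≤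
        C * ∫ x in P.face j, f x ^ 2 ∂(μH[(2 : ℝ)]) := by
  let F : polySubmodule k →ₗ[ℝ] (E3 → ℝ) :=
    { toFun := fun f x => P.faceBubble j x * f.1 (P.faceProj j x)
      map_add' := fun f g => by ext x; simp [mul_add]
      map_smul' := fun c f => by ext x; simp [mul_left_comm] }
  obtain ⟨C, hC⟩ := exists_integral_sq_le_mul_integral_sq
    (μ := volume.restrict P.carrier) (ν := μH[(2 : ℝ)].restrict (P.face j))
    F (polySubmodule k).subtype
    (fun f => memLp_faceBubble_mul_comp_faceProj (mem_polySubmodule.1 f.2).continuous)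
    (fun f => (mem_polySubmodule.1 f.2).continuous.memLp_two_restrict_of_isBounded
      (P.face_isCompact j).isBounded (P.face_isCompact j).measurableSet
      (hausdorffMeasure_face_lt_top ht₁ ht₂ ht₁₂ ht₁n ht₂n))
    (fun f hf => funext fun x => mul_eq_zero_of_right _
      (comp_faceProj_eq_zero_of_ae_face ht₁ ht₂ ht₁₂ ht₁n ht₂n (mem_polySubmodule.1 f.2) hf x))
  exact ⟨C, fun f hf => hC ⟨f, mem_polySubmodule.2 hf⟩⟩

theorem exists_integral_norm_faceBubble_smul_sq_le (ht₁ : ‖t₁‖ = 1) (ht₂ : ‖t₂‖ = 1)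
    (ht₁₂ : dot3 t₁ t₂ = 0) (ht₁n : dot3 t₁ (P.normal j) = 0) (ht₂n : dot3 t₂ (P.normal j) = 0)
    (k : ℕ) :
    ∃ C : ℝ, ∀ w : E3 → E3, PolyVec k w →
      ∫ x in P.carrier, ‖P.faceBubble j x • w (P.faceProj j x)‖ ^ 2 ≤
        C * ∫ x in P.face j, ‖w x‖ ^ 2 ∂(μH[(2 : ℝ)]) := by
  obtain ⟨C, hC⟩ := exists_integral_faceBubble_mul_sq_le ht₁ ht₂ ht₁₂ ht₁n ht₂n k
  refine ⟨C, fun w hw => ?_⟩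
  simp only [norm_sq_eq_sum, PiLp.smul_apply, smul_eq_mul]
  rw [integral_finsetSum _ fun c _ =>
      (memLp_faceBubble_mul_comp_faceProj (hw c).continuous).integrable_sq,
    integral_finsetSum _ fun c _ =>
      ((hw c).continuous.memLp_two_restrict_of_isBounded
        (P.face_isCompact j).isBounded (P.face_isCompact j).measurableSet
        (hausdorffMeasure_face_lt_top ht₁ ht₂ ht₁₂ ht₁n ht₂n)).integrable_sq,
    Finset.mul_sum]
  exact Finset.sum_le_sum fun c _ => hC _ (hw c)

end PolyhedralElement

section VectorFields

theorem PolyVec.curl3 {k : ℕ} {v : E3 → E3} (hv : PolyVec k v) : PolyVec k (curl3 v) := by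
  intro c
  fin_cases c
  · exact ((hv 2).pd 1).sub ((hv 1).pd 2)
  · exact ((hv 0).pd 2).sub ((hv 2).pd 0)
  · exact ((hv 1).pd 0).sub ((hv 0).pd 1)

theorem PolyVec.sub {k : ℕ} {v w : E3 → E3} (hv : PolyVec k v) (hw : PolyVec k w) :
    PolyVec k (fun x => v x - w x) :=
  fun c => (hv c).sub (hw c)

theorem PolyVec.add {k : ℕ} {v w : E3 → E3} (hv : PolyVec k v) (hw : PolyVec k w) :
    PolyVec k (fun x => v x + w x) :=
  fun c => (hv c).add (hw c)

theorem PolyFun.smul_const {k : ℕ} {f : E3 → ℝ} (hf : PolyFun k f) (t : E3) :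
    PolyVec k (fun x => f x • t) :=
  fun c => hf.mul_const (t c)

theorem PolyVec.cross3_const {k : ℕ} {v : E3 → E3} (hv : PolyVec k v) (n : E3) :
    PolyVec k (fun x => cross3 (v x) n) := by
  intro c
  fin_cases c
  · exact ((hv 1).mul_const _).sub ((hv 2).mul_const _)
  · exact ((hv 2).mul_const _).sub ((hv 0).mul_const _)
  · exact ((hv 0).mul_const _).sub ((hv 1).mul_const _)

end VectorFields

/-- for `q(X) = ((v_n − ∇×v₀) × n_j)(π_j(X)) · φ_{f_j}(X)` one has
`‖q‖²_{L²(T)} ≤ C h_T ∫_{f_j} |(v_n − ∇×v₀) × n_j|² dS`, with `C` depending only on the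
element and `k`. -/
theorem statement11 {N : ℕ} (P : PolyhedralElement N) (j : Fin N) (k : ℕ) (hk : 1 ≤ k)
    (t₁ t₂ : E3) (ht₁ : ‖t₁‖ = 1) (ht₂ : ‖t₂‖ = 1) (ht₁₂ : dot3 t₁ t₂ = 0)
    (ht₁n : dot3 t₁ (P.normal j) = 0) (ht₂n : dot3 t₂ (P.normal j) = 0) :
    ∃ C : ℝ, ∀ v₀ : E3 → E3, PolyVec k v₀ →
      ∀ v₃ v₄ : E3 → ℝ, PolyFun (k - 1) v₃ → PolyFun (k - 1) v₄ →
      (∫ x in P.carrier,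
        ‖P.faceBubble j x •
          cross3 ((v₃ (P.faceProj j x) • t₁ + v₄ (P.faceProj j x) • t₂)
            - curl3 v₀ (P.faceProj j x)) (P.normal j)‖ ^ 2) ≤
      C * P.hT * ∫ x in P.face j,
        ‖cross3 ((v₃ x • t₁ + v₄ x • t₂) - curl3 v₀ x) (P.normal j)‖ ^ 2 ∂(μH[(2 : ℝ)]) := by
  obtain ⟨C, hC⟩ := PolyhedralElement.exists_integral_norm_faceBubble_smul_sq_le
    ht₁ ht₂ ht₁₂ ht₁n ht₂n k
  refine ⟨C / P.hT, fun v₀ hv₀ v₃ v₄ hv₃ hv₄ => ?_⟩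
  rw [div_mul_cancel₀ _ P.hT_pos.ne']
  have hw : PolyVec k fun x =>
      cross3 ((v₃ x • t₁ + v₄ x • t₂) - curl3 v₀ x) (P.normal j) :=
    PolyVec.cross3_const (PolyVec.sub
      (PolyVec.add ((hv₃.mono (Nat.sub_le k 1)).smul_const t₁)
        ((hv₄.mono (Nat.sub_le k 1)).smul_const t₂)) hv₀.curl3) (P.normal j)
  have h := hC _ hw
  exact h

end
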